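/- arXiv:2411.04274 — 6 statements merged into one kernel-verified Lean document; each statement's English description precedes it below -/
import Mathlib

section
/- (Necessity in Theorem 2.) Suppose α = 1 and the EA condition ∑_{n=1}^N w(n) = ∑_{n=1}^N d(n) holds. If there exists a feasible trajectory with energy rating B and power rating P = B/Δ whose total peaker energy ∑_{n=1}^N g(n) and total lost wind energy ∑_{n=1}^N l(n) are both zero, then B ≥ max_{0≤n≤N} R(n) − min_{0≤n≤N} R(n). -/
open Finset

/-- A feasible trajectory for a battery with energy rating `B`, power rating `P`,
loss factor `α`, time step `Δ`, wind `w` and demand `d`, over time horizon `N`: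
state `x : {0,…,N} → ℝ`, peaker energy `g` and lost wind energy `l` on `{1,…,N}`. -/
def Feasible (N : ℕ) (Δ α B P : ℝ) (w d : ℕ → ℝ) (x g l : ℕ → ℝ) : Prop :=
  (∀ n, 1 ≤ n → n ≤ N → 0 ≤ g n) ∧
  (∀ n, 1 ≤ n → n ≤ N → 0 ≤ l n) ∧
  (∀ m, m ≤ N → 0 ≤ x m ∧ x m ≤ B) ∧
  (∀ n, 1 ≤ n → n ≤ N → |x n - α * x (n - 1)| ≤ Δ * P) ∧
  (∀ n, 1 ≤ n → n ≤ N → x n = α * x (n - 1) + (w n - d n) + (g n - l n))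

/-- Cumulative excess demand `R(n) = ∑_{i=1}^n (d i - w i)`, with `R 0 = 0`. -/
def cumR (w d : ℕ → ℝ) (n : ℕ) : ℝ := ∑ i ∈ Icc 1 n, (d i - w i)

/-- Without peaker energy or losses, a lossless battery's stored energy is its initial energy
minus the cumulative excess demand. -/
theorem Feasible.state_eq_sub_cumR {N : ℕ} {Δ B P : ℝ} {w d x g l : ℕ → ℝ}
    (h : Feasible N Δ 1 B P w d x g l)
    (hg : ∑ n ∈ Icc 1 N, g n = 0) (hl : ∑ n ∈ Icc 1 N, l n = 0) {n : ℕ} (hn : n ≤ N) :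
    x n = x 0 - cumR w d n := by
  obtain ⟨hg0, hl0, -, -, hx⟩ := h
  rw [sum_eq_zero_iff_of_nonneg fun i hi => hg0 i (mem_Icc.1 hi).1 (mem_Icc.1 hi).2] at hg
  rw [sum_eq_zero_iff_of_nonneg fun i hi => hl0 i (mem_Icc.1 hi).1 (mem_Icc.1 hi).2] at hl
  induction n with
  | zero => simp [cumR]
  | succ k ih =>
    have hk : k + 1 ∈ Icc 1 N := mem_Icc.2 ⟨by omega, hn⟩
    have hR : cumR w d (k + 1) = cumR w d k + (d (k + 1) - w (k + 1)) :=
      sum_Icc_succ_top (by omega) _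
    have hstep := hx (k + 1) (by omega) hn
    rw [hg _ hk, hl _ hk, Nat.add_sub_cancel, ih (by omega)] at hstep
    rw [hstep, hR]
    ring

/-- Necessity in Theorem 2: if `α = 1`, the EA condition holds, and some feasible
trajectory with ratings `(B, B/Δ)` has zero total peaker energy and zero total lost
wind energy, then `B ≥ max_{0≤n≤N} R n − min_{0≤n≤N} R n`. -/
theorem stmt4 (N : ℕ) (hN : 1 ≤ N) (Δ : ℝ) (hΔ : 0 < Δ)
    (B : ℝ) (hB : 0 ≤ B) (w d : ℕ → ℝ)
    (hEA : ∑ n ∈ Icc 1 N, w n = ∑ n ∈ Icc 1 N, d n)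
    (x g l : ℕ → ℝ)
    (hfeas : Feasible N Δ 1 B (B / Δ) w d x g l)
    (hg : ∑ n ∈ Icc 1 N, g n = 0)
    (hl : ∑ n ∈ Icc 1 N, l n = 0) :
    (Icc 0 N).sup' (Finset.nonempty_Icc.mpr (Nat.zero_le N)) (cumR w d)
      - (Icc 0 N).inf' (Finset.nonempty_Icc.mpr (Nat.zero_le N)) (cumR w d) ≤ B := by
  obtain ⟨a, ha, hmax⟩ :=
    exists_mem_eq_sup' (Finset.nonempty_Icc.mpr (Nat.zero_le N)) (cumR w d)
  obtain ⟨b, hb, hmin⟩ :=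
    exists_mem_eq_inf' (Finset.nonempty_Icc.mpr (Nat.zero_le N)) (cumR w d)
  have haN := (mem_Icc.1 ha).2
  have hbN := (mem_Icc.1 hb).2
  have hxa := hfeas.state_eq_sub_cumR hg hl haN
  have hxb := hfeas.state_eq_sub_cumR hg hl hbN
  have hx := hfeas.2.2.1
  rw [hmax, hmin]
  linarith [(hx a haN).1, (hx b hbN).2]
end

section
/- (Sufficiency in Theorem 2.) Suppose α = 1 and the EA condition ∑_{n=1}^N w(n) = ∑_{n=1}^N d(n) holds. Let B = max_{0≤n≤N} R(n) − min_{0≤n≤N} R(n) and P = B/Δ. Then there exists a feasible trajectory with g(n) = 0 and l(n) = 0 for all n; namely, the initial state x(0) = max_{0≤n≤N} R(n) and x(n) = x(0) − R(n) for n = 1,…,N give such a trajectory. In particular the minimum total peaker energy for these ratings is 0. -/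
open Finset

theorem cumR_eq_pred_add (w d : ℕ → ℝ) {n : ℕ} (hn : 1 ≤ n) :
    cumR w d n = cumR w d (n - 1) + (d n - w n) := by
  obtain ⟨k, rfl⟩ := Nat.exists_eq_add_of_le' hn
  simp only [cumR, Nat.add_sub_cancel, Finset.sum_Icc_succ_top hn]

/-- If `cumR` takes values in `[a, b]` on `{0,…,N}`, then the trajectory `b - cumR` needs neither
peaker nor lost energy for the energy rating `b - a` and power rating `(b - a) / Δ`. -/
theorem feasible_sub_cumR {N : ℕ} {Δ a b : ℝ} (hΔ : 0 < Δ) {w d : ℕ → ℝ}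
    (ha : ∀ n ≤ N, a ≤ cumR w d n) (hb : ∀ n ≤ N, cumR w d n ≤ b) :
    Feasible N Δ 1 (b - a) ((b - a) / Δ) w d (fun n => b - cumR w d n)
      (fun _ => 0) (fun _ => 0) := by
  refine ⟨fun _ _ _ => le_rfl, fun _ _ _ => le_rfl, fun m hm => ?_, fun n _ hn => ?_,
    fun n hn _ => ?_⟩
  · exact ⟨sub_nonneg.mpr (hb m hm), sub_le_sub_left (ha m hm) b⟩
  · have hn' : n - 1 ≤ N := (Nat.sub_le n 1).trans hn
    rw [mul_div_cancel₀ _ hΔ.ne', abs_le]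
    constructor <;> linarith [ha n hn, hb n hn, ha _ hn', hb _ hn']
  · linarith [cumR_eq_pred_add w d hn]

/-- Sufficiency in Theorem 2: if `α = 1` and the EA condition holds, then with
`B = max R − min R` and `P = B/Δ`, the trajectory `x n = (max R) − R n`, `g ≡ 0`,
`l ≡ 0` is feasible; in particular the minimum total peaker energy is `0`. -/
theorem stmt5 (N : ℕ) (hN : 1 ≤ N) (Δ : ℝ) (hΔ : 0 < Δ) (w d : ℕ → ℝ)
    (hEA : ∑ n ∈ Icc 1 N, w n = ∑ n ∈ Icc 1 N, d n) :
    Feasible N Δ 1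
        ((Icc 0 N).sup' (Finset.nonempty_Icc.mpr (Nat.zero_le N)) (cumR w d)
          - (Icc 0 N).inf' (Finset.nonempty_Icc.mpr (Nat.zero_le N)) (cumR w d))
        (((Icc 0 N).sup' (Finset.nonempty_Icc.mpr (Nat.zero_le N)) (cumR w d)
          - (Icc 0 N).inf' (Finset.nonempty_Icc.mpr (Nat.zero_le N)) (cumR w d)) / Δ)
        w d
        (fun n => (Icc 0 N).sup' (Finset.nonempty_Icc.mpr (Nat.zero_le N)) (cumR w d)
          - cumR w d n)
        (fun _ => 0) (fun _ => 0) ∧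
    sInf {S : ℝ | ∃ x g l : ℕ → ℝ,
        Feasible N Δ 1
          ((Icc 0 N).sup' (Finset.nonempty_Icc.mpr (Nat.zero_le N)) (cumR w d)
            - (Icc 0 N).inf' (Finset.nonempty_Icc.mpr (Nat.zero_le N)) (cumR w d))
          (((Icc 0 N).sup' (Finset.nonempty_Icc.mpr (Nat.zero_le N)) (cumR w d)
            - (Icc 0 N).inf' (Finset.nonempty_Icc.mpr (Nat.zero_le N)) (cumR w d)) / Δ)
          w d x g l ∧ S = ∑ n ∈ Icc 1 N, g n} = 0 := by
  have hne : (Icc 0 N).Nonempty := Finset.nonempty_Icc.mpr (Nat.zero_le N)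
  have hfeas := feasible_sub_cumR (a := (Icc 0 N).inf' hne (cumR w d))
    (b := (Icc 0 N).sup' hne (cumR w d)) hΔ
    (fun n hn => Finset.inf'_le (cumR w d) (Finset.mem_Icc.mpr ⟨n.zero_le, hn⟩))
    (fun n hn => Finset.le_sup' (cumR w d) (Finset.mem_Icc.mpr ⟨n.zero_le, hn⟩))
  refine ⟨hfeas, IsLeast.csInf_eq ⟨⟨_, _, _, hfeas, by simp⟩, ?_⟩⟩
  rintro S ⟨x, g, l, hg, rfl⟩
  exact Finset.sum_nonneg fun n hn =>
    hg.1 n (Finset.mem_Icc.mp hn).1 (Finset.mem_Icc.mp hn).2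
end

section
/- (Sufficiency for zero peaker energy with losses allowed.) Suppose α = 1, Δ·P ≥ B, and B ≥ max_{0≤m≤n≤N} (R(n) − R(m)). Then there exists a feasible trajectory with g(n) = 0 for all n = 1,…,N; that is, a battery of energy rating B^#_g = max_{0≤m≤n≤N} (R(n) − R(m)) suffices to reduce the total peaker energy to zero when wind spillage is permitted. -/
open Finset

/-- Battery level starting full and charging whenever possible: excess energy is spilled
exactly when the battery is full. -/
def greedyLevel (B : ℝ) (w d : ℕ → ℝ) : ℕ → ℝ
  | 0 => B
  | n + 1 => min B (greedyLevel B w d n - (d (n + 1) - w (n + 1)))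

theorem greedyLevel_le (B : ℝ) (w d : ℕ → ℝ) (n : ℕ) : greedyLevel B w d n ≤ B := by
  cases n with
  | zero => exact le_rfl
  | succ n => exact min_le_left _ _

theorem cumR_succ (w d : ℕ → ℝ) (n : ℕ) :
    cumR w d (n + 1) = cumR w d n + (d (n + 1) - w (n + 1)) :=
  Finset.sum_Icc_succ_top (by omega) _

/-- The greedy level is `B` minus the cumulative excess demand since the battery was last full. -/
theorem exists_greedyLevel_eq (B : ℝ) (w d : ℕ → ℝ) (n : ℕ) :
    ∃ m ≤ n, greedyLevel B w d n = B - (cumR w d n - cumR w d m) := by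
  induction n with
  | zero => exact ⟨0, le_rfl, by simp [greedyLevel]⟩
  | succ n ih =>
    obtain ⟨m, hm, h⟩ := ih
    rcases min_choice B (greedyLevel B w d n - (d (n + 1) - w (n + 1))) with hc | hc
    · exact ⟨n + 1, le_rfl, by rw [greedyLevel, hc]; ring⟩
    · exact ⟨m, by omega, by rw [greedyLevel, hc, h, cumR_succ]; ring⟩

/-- Sufficiency for zero peaker energy with losses allowed: if `α = 1`, `Δ·P ≥ B`, and
`B ≥ R n − R m` for all `0 ≤ m ≤ n ≤ N` (i.e. `B ≥ B^#_g`), then some feasible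
trajectory has `g n = 0` for all `n = 1,…,N`. -/
theorem stmt6 (N : ℕ) (hN : 1 ≤ N) (Δ : ℝ) (hΔ : 0 < Δ)
    (B P : ℝ) (hB : 0 ≤ B) (hP : 0 ≤ P) (hPB : B ≤ Δ * P) (w d : ℕ → ℝ)
    (hBpairs : ∀ m n : ℕ, m ≤ n → n ≤ N → cumR w d n - cumR w d m ≤ B) :
    ∃ x g l : ℕ → ℝ, Feasible N Δ 1 B P w d x g l ∧
      ∀ n, 1 ≤ n → n ≤ N → g n = 0 := by
  have hnonneg : ∀ n ≤ N, 0 ≤ greedyLevel B w d n := by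
    intro n hn
    obtain ⟨m, hm, h⟩ := exists_greedyLevel_eq B w d n
    linarith [hBpairs m n hm hn]
  refine ⟨greedyLevel B w d, fun _ => 0,
    fun n => greedyLevel B w d (n - 1) - (d n - w n) - greedyLevel B w d n,
    ⟨fun _ _ _ => le_rfl, ?_, fun m hm => ⟨hnonneg m hm, greedyLevel_le B w d m⟩, ?_, ?_⟩,
    fun _ _ _ => rfl⟩
  · intro n hn _
    obtain ⟨k, rfl⟩ := Nat.exists_eq_add_of_le' hn
    exact sub_nonneg.mpr (min_le_right _ _)
  · intro n _ hn
    rw [one_mul, abs_le]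
    have := hnonneg n hn
    have := hnonneg (n - 1) (by omega)
    have := greedyLevel_le B w d n
    have := greedyLevel_le B w d (n - 1)
    constructor <;> linarith
  · intro n _ _
    ring
end

section
/- (Necessity for zero peaker energy with losses allowed.) Suppose α = 1 and there exists a feasible trajectory with energy rating B and some power rating P ≥ 0 such that g(n) = 0 for all n = 1,…,N. Then B ≥ max_{0≤m≤n≤N} (R(n) − R(m)). -/
open Finset

/-- Without losses in storage and without peaker energy, the excess demand over a period is at
most the energy drawn from the battery. -/
theorem Feasible.cumR_sub_le {N : ℕ} {Δ B P : ℝ} {w d x g l : ℕ → ℝ}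
    (hfeas : Feasible N Δ 1 B P w d x g l) (hg : ∀ n, 1 ≤ n → n ≤ N → g n = 0)
    {m n : ℕ} (hmn : m ≤ n) (hnN : n ≤ N) : cumR w d n - cumR w d m ≤ x m - x n := by
  obtain ⟨-, hl, -, -, hx⟩ := hfeas
  induction n, hmn using Nat.le_induction with
  | base => simp
  | succ n _ ih =>
    have hprev := ih (by omega)
    have hbal := hx (n + 1) (by omega) hnN
    rw [Nat.add_sub_cancel, hg (n + 1) (by omega) hnN] at hbal
    rw [cumR_succ]
    linarith [hl (n + 1) (by omega) hnN]

/-- Necessity for zero peaker energy with losses allowed: if `α = 1` and some feasible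
trajectory with energy rating `B` (and some `P ≥ 0`) has `g n = 0` for all `n`, then
`B ≥ R n − R m` for all `0 ≤ m ≤ n ≤ N`, i.e. `B ≥ B^#_g`. -/
theorem stmt7 (N : ℕ) (hN : 1 ≤ N) (Δ : ℝ) (hΔ : 0 < Δ)
    (B P : ℝ) (hB : 0 ≤ B) (hP : 0 ≤ P) (w d : ℕ → ℝ)
    (x g l : ℕ → ℝ) (hfeas : Feasible N Δ 1 B P w d x g l)
    (hg : ∀ n, 1 ≤ n → n ≤ N → g n = 0) :
    ∀ m n : ℕ, m ≤ n → n ≤ N → cumR w d n - cumR w d m ≤ B := by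
  intro m n hmn hnN
  have hdraw := hfeas.cumR_sub_le hg hmn hnN
  linarith [(hfeas.2.2.1 m (hmn.trans hnN)).2, (hfeas.2.2.1 n hnN).1]
end

section
/- (Three-index lower bound underlying the recursion on G.) Suppose α = 1. For any feasible trajectory with parameters B ≥ 0, P ≥ 0, and any indices 0 ≤ c ≤ a ≤ b ≤ N, one has ∑_{n=c+1}^{b} g(n) ≥ max(R(b) − R(a) − B, 0); in particular, for local maxima m_i of R and local minima n_j ≤ m_i, the cumulative peaker energy satisfies G(m_i) − G(m_{j−1}) ≥ max(Ξ(i,j) − B, 0) where Ξ(i,j) = R(m_i) − R(n_j). -/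
open Finset

/-- Without battery losses, the increase of `R` plus the energy stored over `{a+1,…,b}` is at
most the peaker energy used there. -/
theorem Feasible.cumR_sub_add_sub_le_sum {N : ℕ} {Δ B P : ℝ} {w d x g l : ℕ → ℝ}
    (h : Feasible N Δ 1 B P w d x g l) {a b : ℕ} (hab : a ≤ b) (hbN : b ≤ N) :
    cumR w d b - cumR w d a + (x b - x a) ≤ ∑ n ∈ Icc (a + 1) b, g n := by
  obtain ⟨-, hl, -, -, hx⟩ := h
  induction b, hab using Nat.le_induction with
  | base => simp
  | succ b hab ih =>
    have hR : cumR w d (b + 1) = cumR w d b + (d (b + 1) - w (b + 1)) :=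
      sum_Icc_succ_top (by omega) _
    have hstep := hx (b + 1) (by omega) hbN
    rw [Nat.add_sub_cancel] at hstep
    rw [sum_Icc_succ_top (by omega)]
    linarith [ih (by omega), hl (b + 1) (by omega) hbN]

/-- Three-index lower bound underlying the recursion on `G`: if `α = 1`, for any
feasible trajectory and any `0 ≤ c ≤ a ≤ b ≤ N`,
`∑_{n=c+1}^b g n ≥ max(R b − R a − B, 0)`; in particular, with `G n = ∑_{i=1}^n g i`,
`G(mᵢ) − G(m_{j−1}) ≥ max(Ξ(i,j) − B, 0)` for local maxima `mᵢ` of `R` and local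
minima `n_j ≤ mᵢ`, where `Ξ(i,j) = R(mᵢ) − R(n_j)`. -/
theorem stmt12 (N : ℕ) (hN : 1 ≤ N) (Δ : ℝ) (hΔ : 0 < Δ)
    (B P : ℝ) (hB : 0 ≤ B) (hP : 0 ≤ P)
    (w d : ℕ → ℝ) (x g l : ℕ → ℝ)
    (hfeas : Feasible N Δ 1 B P w d x g l) :
    ∀ c a b : ℕ, c ≤ a → a ≤ b → b ≤ N →
      ∑ n ∈ Icc (c + 1) b, g n ≥ max (cumR w d b - cumR w d a - B) 0 := by
  intro c a b hca hab hbN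
  have hg : ∀ n ∈ Icc (c + 1) b, 0 ≤ g n := fun n hn => by
    rw [mem_Icc] at hn
    exact hfeas.1 n (by omega) (by omega)
  refine max_le ?_ (sum_nonneg hg)
  have hsub : ∑ n ∈ Icc (a + 1) b, g n ≤ ∑ n ∈ Icc (c + 1) b, g n :=
    sum_le_sum_of_subset_of_nonneg (Icc_subset_Icc_left (by omega)) fun n hn _ => hg n hn
  have hx := hfeas.2.2.1
  linarith [hfeas.cumR_sub_add_sub_le_sum hab hbN, (hx a (hab.trans hbN)).2, (hx b hbN).1]
end

section
/- (Convexity of the power alignment function.) Let V(B, P) denote the infimum of the total peaker energy ∑_{n=1}^N g(n) over all feasible trajectories with parameters (B, P). Then V is a convex function of (B, P) on [0,∞) × [0,∞): for all (B₁,P₁), (B₂,P₂) with nonnegative entries and all t ∈ [0,1], V(t·B₁ + (1−t)·B₂, t·P₁ + (1−t)·P₂) ≤ t·V(B₁,P₁) + (1−t)·V(B₂,P₂). -/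
open Finset

theorem Feasible.of_zero_state (N : ℕ) (Δ α B P : ℝ) (w d : ℕ → ℝ) (hΔ : 0 ≤ Δ) (hB : 0 ≤ B)
    (hP : 0 ≤ P) :
    Feasible N Δ α B P w d 0 (fun n => max (d n - w n) 0) (fun n => max (w n - d n) 0) := by
  refine ⟨fun n _ _ => le_max_right _ _, fun n _ _ => le_max_right _ _,
    fun m _ => ⟨le_rfl, hB⟩, fun n _ _ => ?_, fun n _ _ => ?_⟩
  · simpa using mul_nonneg hΔ hP
  · have h := max_zero_sub_eq_self (d n - w n)
    rw [neg_sub] at h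
    simp only [Pi.zero_apply, h]
    ring

theorem Feasible.convex_comb {N : ℕ} {Δ α B₁ B₂ P₁ P₂ s t : ℝ} {w d x₁ g₁ l₁ x₂ g₂ l₂ : ℕ → ℝ}
    (h₁ : Feasible N Δ α B₁ P₁ w d x₁ g₁ l₁) (h₂ : Feasible N Δ α B₂ P₂ w d x₂ g₂ l₂)
    (hs : 0 ≤ s) (ht : 0 ≤ t) (hst : s + t = 1) :
    Feasible N Δ α (s * B₁ + t * B₂) (s * P₁ + t * P₂) w d
      (fun n => s * x₁ n + t * x₂ n) (fun n => s * g₁ n + t * g₂ n)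
      (fun n => s * l₁ n + t * l₂ n) := by
  obtain ⟨hg₁, hl₁, hx₁, hp₁, he₁⟩ := h₁
  obtain ⟨hg₂, hl₂, hx₂, hp₂, he₂⟩ := h₂
  refine ⟨fun n h1 hn => ?_, fun n h1 hn => ?_, fun m hm => ⟨?_, ?_⟩, fun n h1 hn => ?_,
    fun n h1 hn => ?_⟩
  · exact add_nonneg (mul_nonneg hs (hg₁ n h1 hn)) (mul_nonneg ht (hg₂ n h1 hn))
  · exact add_nonneg (mul_nonneg hs (hl₁ n h1 hn)) (mul_nonneg ht (hl₂ n h1 hn))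
  · exact add_nonneg (mul_nonneg hs (hx₁ m hm).1) (mul_nonneg ht (hx₂ m hm).1)
  · exact add_le_add (mul_le_mul_of_nonneg_left (hx₁ m hm).2 hs)
      (mul_le_mul_of_nonneg_left (hx₂ m hm).2 ht)
  · have a₁ := abs_le.mp (hp₁ n h1 hn)
    have a₂ := abs_le.mp (hp₂ n h1 hn)
    have u₁ := mul_le_mul_of_nonneg_left a₁.1 hs
    have v₁ := mul_le_mul_of_nonneg_left a₁.2 hs
    have u₂ := mul_le_mul_of_nonneg_left a₂.1 ht
    have v₂ := mul_le_mul_of_nonneg_left a₂.2 ht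
    exact abs_le.mpr ⟨by linarith, by linarith⟩
  · linear_combination s * he₁ n h1 hn + t * he₂ n h1 hn + (w n - d n) * hst

theorem Feasible.sum_nonneg {N : ℕ} {Δ α B P : ℝ} {w d x g l : ℕ → ℝ}
    (h : Feasible N Δ α B P w d x g l) : 0 ≤ ∑ n ∈ Icc 1 N, g n :=
  Finset.sum_nonneg fun n hn => h.1 n (Finset.mem_Icc.mp hn).1 (Finset.mem_Icc.mp hn).2

/-- Convexity of the power alignment function: the infimum `V(B,P)` of the total
peaker energy over feasible trajectories is a convex function of `(B, P)` on
`[0,∞) × [0,∞)`. -/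
theorem stmt17 (N : ℕ) (hN : 1 ≤ N) (Δ : ℝ) (hΔ : 0 < Δ)
    (α : ℝ) (hα0 : 0 ≤ α) (hα1 : α ≤ 1) (w d : ℕ → ℝ)
    (B₁ B₂ P₁ P₂ : ℝ) (hB₁ : 0 ≤ B₁) (hB₂ : 0 ≤ B₂) (hP₁ : 0 ≤ P₁) (hP₂ : 0 ≤ P₂)
    (t : ℝ) (ht0 : 0 ≤ t) (ht1 : t ≤ 1) :
    sInf {S : ℝ | ∃ x g l : ℕ → ℝ,
        Feasible N Δ α (t * B₁ + (1 - t) * B₂) (t * P₁ + (1 - t) * P₂) w d x g l ∧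
        S = ∑ n ∈ Icc 1 N, g n}
      ≤ t * sInf {S : ℝ | ∃ x g l : ℕ → ℝ,
            Feasible N Δ α B₁ P₁ w d x g l ∧ S = ∑ n ∈ Icc 1 N, g n}
        + (1 - t) * sInf {S : ℝ | ∃ x g l : ℕ → ℝ,
            Feasible N Δ α B₂ P₂ w d x g l ∧ S = ∑ n ∈ Icc 1 N, g n} := by
  have exists_lt : ∀ B P : ℝ, 0 ≤ B → 0 ≤ P → ∀ ε : ℝ, 0 < ε → ∃ x g l : ℕ → ℝ,
      Feasible N Δ α B P w d x g l ∧ ∑ n ∈ Icc 1 N, g n <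
        sInf {S : ℝ | ∃ x g l : ℕ → ℝ,
          Feasible N Δ α B P w d x g l ∧ S = ∑ n ∈ Icc 1 N, g n} + ε := by
    intro B P hB hP ε hε
    obtain ⟨_, ⟨x, g, l, h, rfl⟩, hlt⟩ := Real.lt_sInf_add_pos
      (s := {S : ℝ | ∃ x g l : ℕ → ℝ,
        Feasible N Δ α B P w d x g l ∧ S = ∑ n ∈ Icc 1 N, g n})
      ⟨_, _, _, _, Feasible.of_zero_state N Δ α B P w d hΔ.le hB hP, rfl⟩ hε
    exact ⟨x, g, l, h, hlt⟩
  refine le_of_forall_pos_le_add fun ε hε => ?_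
  obtain ⟨x₁, g₁, l₁, h₁, hS₁⟩ := exists_lt B₁ P₁ hB₁ hP₁ ε hε
  obtain ⟨x₂, g₂, l₂, h₂, hS₂⟩ := exists_lt B₂ P₂ hB₂ hP₂ ε hε
  have ht1' : 0 ≤ 1 - t := sub_nonneg.mpr ht1
  have h := h₁.convex_comb h₂ ht0 ht1' (add_sub_cancel t 1)
  refine le_trans (csInf_le ⟨0, ?_⟩ ⟨_, _, _, h, rfl⟩) ?_
  · rintro _ ⟨x, g, l, h, rfl⟩
    exact h.sum_nonneg
  · rw [sum_add_distrib, ← mul_sum, ← mul_sum]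
    have k₁ := mul_le_mul_of_nonneg_left hS₁.le ht0
    have k₂ := mul_le_mul_of_nonneg_left hS₂.le ht1'
    linarith
end
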